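/- arXiv:1601.04276 — 3 statements merged into one kernel-verified Lean document; each statement's English description precedes it below -/
import Mathlib

section
/- Fix finite nonempty sets 𝒳, 𝒵, a pmf P_X on 𝒳, and a channel W from 𝒳 to 𝒵. Define g(V‖W|P_X) := ω(V‖W|P_X) + H(P_X∘V) + min{ D(V'‖W|P_X) : V' a channel with P_X∘V' = P_X∘V }, and E_s^cc(P_X,W,R) := min over channels V of { D(V‖W|P_X) + max(R − g(V‖W|P_X), 0) }. Then for all real R, R' with I(P_X,W) < R < R', one has 0 < E_s^cc(P_X,W,R) < E_s^cc(P_X,W,R'); i.e., E_s^cc is positive and strictly increasing in R for R > I(P_X,W). -/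
open Filter

noncomputable section

/-- A probability mass function on a finite alphabet. -/
def IsPMF {α : Type*} [Fintype α] (p : α → ℝ) : Prop :=
  (∀ a, 0 ≤ p a) ∧ ∑ a, p a = 1

/-- A channel from `𝒳` to `𝒵`: each input is mapped to a pmf on `𝒵`. -/
def IsChannel {𝒳 𝒵 : Type*} [Fintype 𝒵] (W : 𝒳 → 𝒵 → ℝ) : Prop :=
  ∀ x, IsPMF (W x)

/-- Absolute continuity: `Q a > 0` implies `Q' a > 0`. -/
def AbsCont {α : Type*} (Q Q' : α → ℝ) : Prop :=
  ∀ a, 0 < Q a → 0 < Q' a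

/-- Kullback–Leibler divergence `D(Q‖Q')` (the sum over the support of `Q`). -/
def klDiv {α : Type*} [Fintype α] (Q Q' : α → ℝ) : ℝ :=
  ∑ a, if 0 < Q a then Q a * Real.log (Q a / Q' a) else 0

/-- `x`-marginal of a joint distribution. -/
def margX {𝒳 𝒵 : Type*} [Fintype 𝒵] (Q : 𝒳 × 𝒵 → ℝ) : 𝒳 → ℝ :=
  fun x => ∑ z, Q (x, z)

/-- `z`-marginal of a joint distribution. -/
def margZ {𝒳 𝒵 : Type*} [Fintype 𝒳] (Q : 𝒳 × 𝒵 → ℝ) : 𝒵 → ℝ :=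
  fun z => ∑ x, Q (x, z)

/-- The joint pmf `(x,z) ↦ P(x) W(z|x)`. -/
def jointPW {𝒳 𝒵 : Type*} (P : 𝒳 → ℝ) (W : 𝒳 → 𝒵 → ℝ) : 𝒳 × 𝒵 → ℝ :=
  fun p => P p.1 * W p.1 p.2

/-- The function `f(Q‖Q') = Σ_{Q(x,z)>0} Q(x,z) ln( Q'(x,z) / (Q'_X(x) Q'_Z(z)) )`. -/
def fFun {𝒳 𝒵 : Type*} [Fintype 𝒳] [Fintype 𝒵] (Q Q' : 𝒳 × 𝒵 → ℝ) : ℝ :=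
  ∑ p, if 0 < Q p then Q p * Real.log (Q' p / (margX Q' p.1 * margZ Q' p.2)) else 0

/-- The output distribution `(P∘V)(z) = Σ_x P(x)V(z|x)`. -/
def outDist {𝒳 𝒵 : Type*} [Fintype 𝒳] (P : 𝒳 → ℝ) (V : 𝒳 → 𝒵 → ℝ) : 𝒵 → ℝ :=
  fun z => ∑ x, P x * V x z

/-- Shannon entropy `H(Q)`. -/
def entropy {α : Type*} [Fintype α] (Q : α → ℝ) : ℝ :=
  -∑ a, if 0 < Q a then Q a * Real.log (Q a) else 0

/-- Conditional KL divergence `D(V‖W|P) = Σ_x P(x) D(V(·|x)‖W(·|x))`, with value `+∞`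
whenever some `x, z` with `P(x) > 0` have `V(z|x) > 0 = W(z|x)`. -/
def condKL {𝒳 𝒵 : Type*} [Fintype 𝒳] [Fintype 𝒵]
    (V W : 𝒳 → 𝒵 → ℝ) (P : 𝒳 → ℝ) : EReal :=
  if ∀ x z, 0 < P x → 0 < V x z → 0 < W x z then
    ((∑ x, P x * klDiv (V x) (W x) : ℝ) : EReal)
  else ⊤

/-- `ω(V‖W|P) = Σ_{(x,z): P(x)V(z|x)>0} P(x)V(z|x) ln W(z|x)`, with value `−∞`
whenever some such `W(z|x)` vanishes. -/
def omegaF {𝒳 𝒵 : Type*} [Fintype 𝒳] [Fintype 𝒵]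
    (V W : 𝒳 → 𝒵 → ℝ) (P : 𝒳 → ℝ) : EReal :=
  if ∀ x z, 0 < P x * V x z → 0 < W x z then
    ((∑ p : 𝒳 × 𝒵, if 0 < P p.1 * V p.1 p.2 then
        P p.1 * V p.1 p.2 * Real.log (W p.1 p.2) else 0 : ℝ) : EReal)
  else ⊥

/-- `g(V‖W|P) = ω(V‖W|P) + H(P∘V) + min{ D(V'‖W|P) : V' a channel with P∘V' = P∘V }`. -/
def gFun {𝒳 𝒵 : Type*} [Fintype 𝒳] [Fintype 𝒵]
    (V W : 𝒳 → 𝒵 → ℝ) (P : 𝒳 → ℝ) : EReal :=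
  omegaF V W P + ((entropy (outDist P V) : ℝ) : EReal) +
    sInf { d : EReal | ∃ V' : 𝒳 → 𝒵 → ℝ, IsChannel V' ∧
      (∀ z, outDist P V' z = outDist P V z) ∧ d = condKL V' W P }

/-- The exact constant-composition secrecy/resolvability exponent
`E_s^cc(P,W,R) = min over channels V of { D(V‖W|P) + [R − g(V‖W|P)]⁺ }`. -/
def EsCC {𝒳 𝒵 : Type*} [Fintype 𝒳] [Fintype 𝒵]
    (P : 𝒳 → ℝ) (W : 𝒳 → 𝒵 → ℝ) (R : ℝ) : EReal :=
  sInf { e : EReal | ∃ V : 𝒳 → 𝒵 → ℝ, IsChannel V ∧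
    e = condKL V W P + max ((R : EReal) - gFun V W P) 0 }

/-- Mutual information `I(P,W)`. -/
def mutInfo {𝒳 𝒵 : Type*} [Fintype 𝒳] [Fintype 𝒵] (P : 𝒳 → ℝ) (W : 𝒳 → 𝒵 → ℝ) : ℝ :=
  ∑ p : 𝒳 × 𝒵, if 0 < P p.1 * W p.1 p.2 then
    P p.1 * W p.1 p.2 * Real.log (W p.1 p.2 / outDist P W p.2) else 0

/-- The channels `V` with `V(·|x) ≪ W(·|x)` for every `x` in the support of `P`. -/
def dominatedChannels {𝒳 𝒵 : Type*} [Fintype 𝒵] (P : 𝒳 → ℝ) (W : 𝒳 → 𝒵 → ℝ) :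
    Set (𝒳 → 𝒵 → ℝ) :=
  {V | IsChannel V ∧ ∀ x z, 0 < P x → W x z = 0 → V x z = 0}

/-- Real-valued conditional divergence. -/
def realKL {𝒳 𝒵 : Type*} [Fintype 𝒳] [Fintype 𝒵] (P : 𝒳 → ℝ) (W V : 𝒳 → 𝒵 → ℝ) : ℝ :=
  ∑ x, P x * ∑ z, (V x z * Real.log (V x z) - V x z * Real.log (W x z))

/-- Real-valued version of `ω(V‖W|P) + H(P∘V)`. -/
def realOmegaH {𝒳 𝒵 : Type*} [Fintype 𝒳] [Fintype 𝒵] (P : 𝒳 → ℝ) (W V : 𝒳 → 𝒵 → ℝ) : ℝ :=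
  ∑ x, ∑ z, P x * V x z * Real.log (W x z) + ∑ z, Real.negMulLog (outDist P V z)

/-- The least divergence among dominated channels with the same output as `V`. -/
def minKL {𝒳 𝒵 : Type*} [Fintype 𝒳] [Fintype 𝒵] (P : 𝒳 → ℝ) (W V : 𝒳 → 𝒵 → ℝ) : ℝ :=
  sInf (realKL P W '' {V' | V' ∈ dominatedChannels P W ∧ outDist P V' = outDist P V})

/-- The objective minimized in the exponent. -/
def exponentObjective {𝒳 𝒵 : Type*} [Fintype 𝒳] [Fintype 𝒵] (P : 𝒳 → ℝ) (W : 𝒳 → 𝒵 → ℝ)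
    (R : ℝ) (V : 𝒳 → 𝒵 → ℝ) : ℝ :=
  realKL P W V + max (R - (realOmegaH P W V + minKL P W V)) 0

section Exponent

variable {𝒳 𝒵 : Type*} [Fintype 𝒳] [Fintype 𝒵] {P : 𝒳 → ℝ} {W V : 𝒳 → 𝒵 → ℝ}

omit [Fintype 𝒵] in
lemma continuous_outDist : Continuous (outDist P : (𝒳 → 𝒵 → ℝ) → 𝒵 → ℝ) := by
  unfold outDist
  fun_prop

lemma continuous_realKL : Continuous (realKL P W) := by
  unfold realKL
  refine continuous_finsetSum _ fun x _ => continuous_const.mul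
    (continuous_finsetSum _ fun z _ => ?_)
  exact (Real.continuous_mul_log.comp (by fun_prop : Continuous fun V : 𝒳 → 𝒵 → ℝ => V x z)).sub
    (by fun_prop)

lemma continuous_realOmegaH : Continuous (realOmegaH P W) := by
  unfold realOmegaH
  refine Continuous.add (by fun_prop) (continuous_finsetSum _ fun z _ => ?_)
  exact Real.continuous_negMulLog.comp ((continuous_apply z).comp continuous_outDist)

omit [Fintype 𝒳] in
lemma self_mem_dominatedChannels (hW : IsChannel W) : W ∈ dominatedChannels P W :=
  ⟨hW, fun _ _ _ h => h⟩

omit [Fintype 𝒳] in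
lemma convex_dominatedChannels : Convex ℝ (dominatedChannels P W) := by
  intro U hU V hV a b ha hb hab
  refine ⟨fun x => ⟨fun z => ?_, ?_⟩, fun x z hx hz => ?_⟩
  · have h1 := (hU.1 x).1 z
    have h2 := (hV.1 x).1 z
    simp only [Pi.add_apply, Pi.smul_apply, smul_eq_mul]
    positivity
  · simp [Finset.sum_add_distrib, ← Finset.mul_sum, (hU.1 x).2, (hV.1 x).2, hab]
  · simp [hU.2 x z hx hz, hV.2 x z hx hz]

omit [Fintype 𝒳] in
lemma isClosed_dominatedChannels : IsClosed (dominatedChannels P W) := by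
  have h : dominatedChannels P W =
      (⋂ x, (⋂ z, {V : 𝒳 → 𝒵 → ℝ | 0 ≤ V x z}) ∩ {V | ∑ z, V x z = 1}) ∩
      ⋂ x, ⋂ z, ⋂ (_ : 0 < P x), ⋂ (_ : W x z = 0), {V | V x z = 0} := by
    ext V
    simp [dominatedChannels, IsChannel, IsPMF]
  rw [h]
  refine IsClosed.inter (isClosed_iInter fun x => IsClosed.inter (isClosed_iInter fun z => ?_) ?_)
    (isClosed_iInter fun x => isClosed_iInter fun z => isClosed_iInter fun _ =>
      isClosed_iInter fun _ => ?_)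
  · exact isClosed_le continuous_const (by fun_prop)
  · exact isClosed_eq (by fun_prop) continuous_const
  · exact isClosed_eq (by fun_prop) continuous_const

omit [Fintype 𝒳] in
lemma isCompact_dominatedChannels : IsCompact (dominatedChannels P W) := by
  refine IsCompact.of_isClosed_subset (isCompact_Icc (a := (0 : 𝒳 → 𝒵 → ℝ)) (b := 1))
    isClosed_dominatedChannels fun V hV => ⟨fun x z => (hV.1 x).1 z, fun x z => ?_⟩
  calc V x z ≤ ∑ z, V x z := Finset.single_le_sum (fun z _ => (hV.1 x).1 z) (Finset.mem_univ z)
    _ = 1 := (hV.1 x).2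

lemma mul_log_sub_mul_log_eq {v w : ℝ} (hvw : w = 0 → v = 0) :
    v * Real.log v - v * Real.log w = w * InformationTheory.klFun (v / w) + (v - w) := by
  rcases eq_or_ne w 0 with hw0 | hw0
  · simp [hw0, hvw hw0]
  rcases eq_or_ne v 0 with hv0 | hv0
  · simp [hv0, InformationTheory.klFun_zero]
  rw [InformationTheory.klFun_apply, Real.log_div hv0 hw0]
  field_simp
  ring

lemma sum_mul_log_sub_mul_log_eq {v w : 𝒵 → ℝ} (hv : IsPMF v) (hw : IsPMF w)
    (h : ∀ z, w z = 0 → v z = 0) :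
    ∑ z, (v z * Real.log (v z) - v z * Real.log (w z)) =
      ∑ z, w z * InformationTheory.klFun (v z / w z) := by
  rw [Finset.sum_congr rfl fun z _ => mul_log_sub_mul_log_eq (h z), Finset.sum_add_distrib,
    Finset.sum_sub_distrib, hv.2, hw.2]
  simp

lemma mul_klFun_div_nonneg {v w : ℝ} (hv : 0 ≤ v) (hw : 0 ≤ w) :
    0 ≤ w * InformationTheory.klFun (v / w) :=
  mul_nonneg hw (InformationTheory.klFun_nonneg (div_nonneg hv hw))

lemma mul_sum_mul_log_nonneg (hP : IsPMF P) (hW : IsChannel W) (hV : V ∈ dominatedChannels P W)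
    (x : 𝒳) : 0 ≤ P x * ∑ z, (V x z * Real.log (V x z) - V x z * Real.log (W x z)) := by
  rcases (hP.1 x).eq_or_lt with hx | hx
  · simp [← hx]
  rw [sum_mul_log_sub_mul_log_eq (hV.1 x) (hW x) fun z => hV.2 x z hx]
  exact mul_nonneg hx.le (Finset.sum_nonneg fun z _ =>
    mul_klFun_div_nonneg ((hV.1 x).1 z) ((hW x).1 z))

lemma realKL_nonneg (hP : IsPMF P) (hW : IsChannel W) (hV : V ∈ dominatedChannels P W) :
    0 ≤ realKL P W V :=
  Finset.sum_nonneg fun x _ => mul_sum_mul_log_nonneg hP hW hV x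

lemma eq_of_realKL_eq_zero (hP : IsPMF P) (hW : IsChannel W) (hV : V ∈ dominatedChannels P W)
    (h : realKL P W V = 0) (x : 𝒳) (hx : 0 < P x) : V x = W x := by
  have h1 := (Finset.sum_eq_zero_iff_of_nonneg fun x _ => mul_sum_mul_log_nonneg hP hW hV x).1 h x
    (Finset.mem_univ x)
  rw [sum_mul_log_sub_mul_log_eq (hV.1 x) (hW x) fun z => hV.2 x z hx] at h1
  have h2 := (mul_eq_zero.1 h1).resolve_left hx.ne'
  funext z
  have h3 := (Finset.sum_eq_zero_iff_of_nonneg fun z _ =>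
    mul_klFun_div_nonneg ((hV.1 x).1 z) ((hW x).1 z)).1 h2 z (Finset.mem_univ z)
  rcases mul_eq_zero.1 h3 with h4 | h4
  · rw [h4, hV.2 x z hx h4]
  · rw [InformationTheory.klFun_eq_zero_iff (div_nonneg ((hV.1 x).1 z) ((hW x).1 z))] at h4
    exact eq_of_div_eq_one h4

lemma realKL_self : realKL P W W = 0 := by simp [realKL]

lemma convexOn_realKL (hP : IsPMF P) : ConvexOn ℝ (dominatedChannels P W) (realKL P W) := by
  refine ⟨convex_dominatedChannels, fun U hU V hV a b ha hb hab => ?_⟩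
  simp only [realKL, smul_eq_mul, Finset.mul_sum, ← Finset.sum_add_distrib]
  refine Finset.sum_le_sum fun x _ => Finset.sum_le_sum fun z _ => ?_
  have h := Real.convexOn_mul_log.2 (Set.mem_Ici.2 ((hU.1 x).1 z)) (Set.mem_Ici.2 ((hV.1 x).1 z))
    ha hb hab
  simp only [smul_eq_mul] at h
  simp only [Pi.add_apply, Pi.smul_apply, smul_eq_mul]
  nlinarith [mul_le_mul_of_nonneg_left h (hP.1 x)]

lemma minKL_le (hP : IsPMF P) (hW : IsChannel W) {V' : 𝒳 → 𝒵 → ℝ}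
    (hV' : V' ∈ dominatedChannels P W) (h : outDist P V' = outDist P V) :
    minKL P W V ≤ realKL P W V' := by
  refine csInf_le ⟨0, ?_⟩ ⟨V', ⟨hV', h⟩, rfl⟩
  rintro _ ⟨U, hU, rfl⟩
  exact realKL_nonneg hP hW hU.1

lemma exists_minKL_eq (hV : V ∈ dominatedChannels P W) :
    ∃ V' ∈ dominatedChannels P W, outDist P V' = outDist P V ∧ realKL P W V' = minKL P W V := by
  have hK : IsCompact {V' | V' ∈ dominatedChannels P W ∧ outDist P V' = outDist P V} :=
    isCompact_dominatedChannels.inter_right (isClosed_eq continuous_outDist continuous_const)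
  obtain ⟨V', hV', h⟩ := (hK.image (continuous_realKL (P := P) (W := W))).sInf_mem
    ⟨_, V, ⟨hV, rfl⟩, rfl⟩
  exact ⟨V', hV'.1, hV'.2, h⟩

lemma lowerSemicontinuousOn_minKL (hP : IsPMF P) (hW : IsChannel W) :
    LowerSemicontinuousOn (minKL P W) (dominatedChannels P W) := by
  rw [lowerSemicontinuousOn_iff_preimage_Iic]
  intro c
  have hK : IsCompact ((dominatedChannels P W ×ˢ dominatedChannels P W) ∩
      {p | outDist P p.2 = outDist P p.1 ∧ realKL P W p.2 ≤ c}) := by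
    refine (isCompact_dominatedChannels.prod isCompact_dominatedChannels).inter_right
      (IsClosed.inter (isClosed_eq ?_ ?_)
        (isClosed_le
          (f := fun p : (𝒳 → 𝒵 → ℝ) × (𝒳 → 𝒵 → ℝ) => realKL P W p.2)
          (g := fun _ => c) ?_ continuous_const))
    · exact continuous_outDist.comp continuous_snd
    · exact continuous_outDist.comp continuous_fst
    · exact continuous_realKL.comp continuous_snd
  refine ⟨_, (hK.image continuous_fst).isClosed, ?_⟩
  ext V
  constructor
  · rintro ⟨hV, hc⟩
    obtain ⟨V', hV', ho, he⟩ := exists_minKL_eq hV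
    exact ⟨hV, (V, V'), ⟨⟨hV, hV'⟩, ho, he.trans_le hc⟩, rfl⟩
  · rintro ⟨hV, ⟨p, ⟨hp, ho, hc⟩, rfl⟩⟩
    exact ⟨hV, (minKL_le hP hW hp.2 ho).trans hc⟩

omit [Fintype 𝒵] in
lemma outDist_add_sub (a b : ℝ) (hab : a + b = 1) {V' : 𝒳 → 𝒵 → ℝ}
    (ho : outDist P V' = outDist P V) (U : 𝒳 → 𝒵 → ℝ) :
    outDist P (a • V' + b • V + (U - V)) = outDist P U := by
  funext z
  have h := congrFun ho z
  simp only [outDist, Pi.add_apply, Pi.sub_apply, Pi.smul_apply, smul_eq_mul] at h ⊢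
  simp only [mul_add, mul_sub, Finset.sum_add_distrib, Finset.sum_sub_distrib, mul_left_comm (P _),
    ← Finset.mul_sum, h]
  linear_combination (∑ x, P x * V x z) * hab

/-- Strict mixtures of `V'` and `V` can be shifted by small `U - V` without leaving the polytope of
dominated channels. -/
lemma eventually_add_sub_mem {V' : 𝒳 → 𝒵 → ℝ} (hV : V ∈ dominatedChannels P W)
    (hV' : V' ∈ dominatedChannels P W) {a b : ℝ} (ha : 0 ≤ a) (hb : 0 < b) (hab : a + b = 1) :
    ∀ᶠ U in nhdsWithin V (dominatedChannels P W),
      a • V' + b • V + (U - V) ∈ dominatedChannels P W := by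
  have hpos : ∀ x z, ∀ᶠ U in nhdsWithin V (dominatedChannels P W),
      0 ≤ (a • V' + b • V + (U - V)) x z := by
    intro x z
    have h' := mul_nonneg ha ((hV'.1 x).1 z)
    rcases ((hV.1 x).1 z).eq_or_lt with h0 | h0
    · filter_upwards [self_mem_nhdsWithin] with U hU
      have := (hU.1 x).1 z
      simp only [Pi.add_apply, Pi.sub_apply, Pi.smul_apply, smul_eq_mul, ← h0]
      linarith
    · have hc : Continuous fun U : 𝒳 → 𝒵 → ℝ => (a • V' + b • V + (U - V)) x z := by
        simp only [Pi.add_apply, Pi.sub_apply, Pi.smul_apply]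
        fun_prop
      refine nhdsWithin_le_nhds ((hc.tendsto V).eventually_const_le ?_)
      simp only [Pi.add_apply, Pi.sub_apply, Pi.smul_apply, smul_eq_mul]
      nlinarith [mul_pos hb h0]
  filter_upwards [self_mem_nhdsWithin, eventually_all.2 fun x => eventually_all.2 (hpos x)]
    with U hU h
  refine ⟨fun x => ⟨h x, ?_⟩, fun x z hx hz => ?_⟩
  · simp [Finset.sum_add_distrib, ← Finset.mul_sum, (hU.1 x).2, (hV.1 x).2, (hV'.1 x).2, hab]
  · simp [hU.2 x z hx hz, hV.2 x z hx hz, hV'.2 x z hx hz]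

lemma upperSemicontinuousOn_minKL (hP : IsPMF P) (hW : IsChannel W) :
    UpperSemicontinuousOn (minKL P W) (dominatedChannels P W) := by
  rw [upperSemicontinuousOn_iff]
  intro V hV
  rw [upperSemicontinuousWithinAt_iff]
  intro c hc
  obtain ⟨V', hV', ho, he⟩ := exists_minKL_eq hV
  have hmix : Continuous fun ε : ℝ => realKL P W ((1 - ε) • V' + ε • V) :=
    continuous_realKL.comp (by fun_prop)
  have hε : ∀ᶠ ε in nhdsWithin (0 : ℝ) (Set.Ioi 0), realKL P W ((1 - ε) • V' + ε • V) < c :=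
    nhdsWithin_le_nhds ((hmix.tendsto 0).eventually_lt_const (by simpa [he] using hc))
  obtain ⟨ε, hεc, hε0, hε1⟩ := (hε.and (Ioo_mem_nhdsGT one_pos)).exists
  have hshift : Continuous fun U : 𝒳 → 𝒵 → ℝ =>
      realKL P W ((1 - ε) • V' + ε • V + (U - V)) := continuous_realKL.comp (by fun_prop)
  filter_upwards [eventually_add_sub_mem hV hV' (sub_nonneg.2 hε1.le) hε0 (sub_add_cancel 1 ε),
    nhdsWithin_le_nhds ((hshift.tendsto V).eventually_lt_const (by simpa using hεc))] with U h1 h2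
  exact (minKL_le hP hW h1 (outDist_add_sub _ _ (sub_add_cancel 1 ε) ho U)).trans_lt h2

lemma continuousOn_minKL (hP : IsPMF P) (hW : IsChannel W) :
    ContinuousOn (minKL P W) (dominatedChannels P W) :=
  continuousOn_iff_lower_upperSemicontinuousOn.2
    ⟨lowerSemicontinuousOn_minKL hP hW, upperSemicontinuousOn_minKL hP hW⟩

lemma condKL_of_mem (hP : IsPMF P) (hW : IsChannel W) (hV : V ∈ dominatedChannels P W) :
    condKL V W P = realKL P W V := by
  have hpos : ∀ x z, 0 < P x → 0 < V x z → 0 < W x z := fun x z hx hv =>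
    ((hW x).1 z).lt_of_ne fun h => hv.ne' (hV.2 x z hx h.symm)
  rw [condKL, if_pos hpos, realKL]
  congr 1
  refine Finset.sum_congr rfl fun x _ => ?_
  rcases (hP.1 x).eq_or_lt with hx | hx
  · simp [← hx]
  congr 1
  refine Finset.sum_congr rfl fun z _ => ?_
  split_ifs with h
  · rw [Real.log_div h.ne' (hpos x z hx h).ne']
    ring
  · rw [le_antisymm (not_lt.1 h) ((hV.1 x).1 z)]
    simp

lemma condKL_of_notMem (hV : IsChannel V) (h : V ∉ dominatedChannels P W) :
    condKL V W P = ⊤ := by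
  rw [condKL, if_neg]
  refine fun hpos => h ⟨hV, fun x z hx hz => ?_⟩
  by_contra hv
  exact (hpos x z hx (((hV x).1 z).lt_of_ne' hv)).ne' hz

lemma sum_ite_mul_log_eq (hP : IsPMF P) (hV : IsChannel V) :
    (∑ p : 𝒳 × 𝒵, if 0 < P p.1 * V p.1 p.2 then
      P p.1 * V p.1 p.2 * Real.log (W p.1 p.2) else 0) =
      ∑ x, ∑ z, P x * V x z * Real.log (W x z) := by
  rw [Fintype.sum_prod_type]
  refine Finset.sum_congr rfl fun x _ => Finset.sum_congr rfl fun z _ => ?_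
  split_ifs with h
  · rfl
  · rw [le_antisymm (not_lt.1 h) (mul_nonneg (hP.1 x) ((hV x).1 z)), zero_mul]

lemma outDist_nonneg (hP : IsPMF P) (hV : IsChannel V) (z : 𝒵) : 0 ≤ outDist P V z :=
  Finset.sum_nonneg fun x _ => mul_nonneg (hP.1 x) ((hV x).1 z)

lemma entropy_eq_sum_negMulLog {Q : 𝒵 → ℝ} (hQ : ∀ z, 0 ≤ Q z) :
    entropy Q = ∑ z, Real.negMulLog (Q z) := by
  rw [entropy, ← Finset.sum_neg_distrib]
  refine Finset.sum_congr rfl fun z _ => ?_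
  split_ifs with h
  · rw [Real.negMulLog]
    ring
  · simp [le_antisymm (not_lt.1 h) (hQ z)]

lemma gFun_of_mem (hP : IsPMF P) (hW : IsChannel W) (hV : V ∈ dominatedChannels P W) :
    gFun V W P = ((realOmegaH P W V + minKL P W V : ℝ) : EReal) := by
  have hpos : ∀ x z, 0 < P x * V x z → 0 < W x z := fun x z h =>
    ((hW x).1 z).lt_of_ne fun hw => h.ne' <| by
      rw [hV.2 x z ((hP.1 x).lt_of_ne' (left_ne_zero_of_mul h.ne')) hw.symm, mul_zero]
  have hinf : sInf {d : EReal | ∃ V' : 𝒳 → 𝒵 → ℝ, IsChannel V' ∧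
      (∀ z, outDist P V' z = outDist P V z) ∧ d = condKL V' W P} = (minKL P W V : EReal) := by
    apply le_antisymm
    · obtain ⟨V', hV', ho, he⟩ := exists_minKL_eq hV
      exact sInf_le ⟨V', hV'.1, congrFun ho, by rw [condKL_of_mem hP hW hV', he]⟩
    · refine le_sInf ?_
      rintro _ ⟨V', hV', ho, rfl⟩
      by_cases h : V' ∈ dominatedChannels P W
      · rw [condKL_of_mem hP hW h]
        exact EReal.coe_le_coe_iff.2 (minKL_le hP hW h (funext ho))
      · rw [condKL_of_notMem hV' h]
        exact le_top
  rw [gFun, hinf, omegaF, if_pos hpos, sum_ite_mul_log_eq hP hV.1,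
    entropy_eq_sum_negMulLog (outDist_nonneg hP hV.1), realOmegaH]
  push_cast
  rfl

lemma realOmegaH_self (hP : IsPMF P) (hW : IsChannel W) : realOmegaH P W W = mutInfo P W := by
  have hmut : mutInfo P W =
      ∑ z, ∑ x, (P x * W x z * Real.log (W x z) - P x * W x z * Real.log (outDist P W z)) := by
    rw [mutInfo, Fintype.sum_prod_type, Finset.sum_comm]
    refine Finset.sum_congr rfl fun z _ => Finset.sum_congr rfl fun x _ => ?_
    have hn := fun x => mul_nonneg (hP.1 x) ((hW x).1 z)
    split_ifs with h
    · have ho : 0 < outDist P W z :=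
        h.trans_le (Finset.single_le_sum (fun x _ => hn x) (Finset.mem_univ x))
      rw [Real.log_div (right_ne_zero_of_mul h.ne') ho.ne', mul_sub]
    · rw [le_antisymm (not_lt.1 h) (hn x)]
      simp
  rw [hmut, realOmegaH, Finset.sum_comm, ← Finset.sum_add_distrib]
  refine Finset.sum_congr rfl fun z _ => ?_
  rw [Finset.sum_sub_distrib, ← Finset.sum_mul, Real.negMulLog, outDist]
  ring

lemma objective_of_mem (hP : IsPMF P) (hW : IsChannel W) (hV : V ∈ dominatedChannels P W)
    (R : ℝ) : condKL V W P + max ((R : EReal) - gFun V W P) 0 =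
      (exponentObjective P W R V : EReal) := by
  rw [condKL_of_mem hP hW hV, gFun_of_mem hP hW hV, exponentObjective,
    EReal.coe_add (realKL P W V), EReal.coe_strictMono.monotone.map_max, EReal.coe_sub,
    EReal.coe_zero]

lemma continuousOn_exponentObjective (hP : IsPMF P) (hW : IsChannel W) (R : ℝ) :
    ContinuousOn (exponentObjective P W R) (dominatedChannels P W) := by
  have h := continuousOn_minKL hP hW
  exact continuous_realKL.continuousOn.add ((continuousOn_const.sub
    (continuous_realOmegaH.continuousOn.add h)).sup continuousOn_const)

lemma EsCC_le (hP : IsPMF P) (hW : IsChannel W) (hV : V ∈ dominatedChannels P W) (R : ℝ) :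
    EsCC P W R ≤ exponentObjective P W R V :=
  sInf_le ⟨V, hV.1, (objective_of_mem hP hW hV R).symm⟩

lemma exists_EsCC_eq (hP : IsPMF P) (hW : IsChannel W) (R : ℝ) :
    ∃ V ∈ dominatedChannels P W, EsCC P W R = exponentObjective P W R V := by
  obtain ⟨V, hV, hmin⟩ := isCompact_dominatedChannels.exists_isMinOn
    ⟨W, self_mem_dominatedChannels hW⟩ (continuousOn_exponentObjective hP hW R)
  refine ⟨V, hV, le_antisymm (EsCC_le hP hW hV R) (le_sInf ?_)⟩
  rintro _ ⟨U, hU, rfl⟩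
  by_cases h : U ∈ dominatedChannels P W
  · rw [objective_of_mem hP hW h]
    exact EReal.coe_le_coe_iff.2 (hmin h)
  · rw [condKL_of_notMem hU h, EReal.top_add_of_ne_bot]
    · exact le_top
    · exact (EReal.bot_lt_zero.trans_le (le_max_right _ _)).ne'

lemma exponentObjective_pos (hP : IsPMF P) (hW : IsChannel W) (hV : V ∈ dominatedChannels P W)
    {R : ℝ} (hR : mutInfo P W < R) : 0 < exponentObjective P W R V := by
  have hmax := le_max_right (R - (realOmegaH P W V + minKL P W V)) 0
  rcases (realKL_nonneg hP hW hV).eq_or_lt with h | h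
  · have hVW := eq_of_realKL_eq_zero hP hW hV h.symm
    have hPV : ∀ x z, P x * V x z = P x * W x z := by
      intro x z
      rcases (hP.1 x).eq_or_lt with hx | hx
      · simp [← hx]
      · rw [hVW x hx]
    have hω : realOmegaH P W V = mutInfo P W := by
      rw [← realOmegaH_self hP hW]
      simp only [realOmegaH, outDist, hPV]
    have hm : minKL P W V ≤ 0 := (minKL_le hP hW hV rfl).trans_eq h.symm
    have := le_max_left (R - (realOmegaH P W V + minKL P W V)) 0
    rw [exponentObjective]
    linarith
  · rw [exponentObjective]
    linarith

lemma exists_exponentObjective_lt (hP : IsPMF P) (hW : IsChannel W)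
    (hV : V ∈ dominatedChannels P W) {R R' : ℝ} (hR : mutInfo P W < R) (hRR' : R < R') :
    ∃ U ∈ dominatedChannels P W, exponentObjective P W R U < exponentObjective P W R' V := by
  have hpos := exponentObjective_pos hP hW hV (hR.trans hRR')
  rcases lt_or_ge (realOmegaH P W V + minKL P W V) R' with hg | hg
  · refine ⟨V, hV, ?_⟩
    rw [exponentObjective, exponentObjective, max_eq_left (sub_pos.2 hg).le]
    gcongr
    exact max_lt (by linarith) (sub_pos.2 hg)
  have hWm : W ∈ dominatedChannels P W := self_mem_dominatedChannels hW
  rw [exponentObjective, max_eq_right (sub_nonpos.2 hg), add_zero] at hpos ⊢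
  have hpath : ContinuousOn (fun t : ℝ => realOmegaH P W ((1 - t) • V + t • W) +
      minKL P W ((1 - t) • V + t • W)) (Set.Icc 0 1) := by
    refine ContinuousOn.comp (t := dominatedChannels P W)
      (g := fun V => realOmegaH P W V + minKL P W V)
      (continuous_realOmegaH.continuousOn.add (continuousOn_minKL hP hW))
      (by fun_prop) fun t ht => ?_
    exact convex_dominatedChannels hV hWm (sub_nonneg.2 ht.2) ht.1 (sub_add_cancel 1 t)
  have hev : ∀ᶠ t in nhdsWithin (0 : ℝ) (Set.Ioc 0 1),
      R < realOmegaH P W ((1 - t) • V + t • W) + minKL P W ((1 - t) • V + t • W) :=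
    ((hpath 0 (by simp)).mono Set.Ioc_subset_Icc_self).eventually_const_lt
      (by simpa using hRR'.trans_le hg)
  have : (nhdsWithin (0 : ℝ) (Set.Ioc 0 1)).NeBot := by
    rw [nhdsWithin_Ioc_eq_nhdsGT one_pos]
    infer_instance
  obtain ⟨t, htR, ht⟩ := (hev.and self_mem_nhdsWithin).exists
  refine ⟨(1 - t) • V + t • W,
    convex_dominatedChannels hV hWm (sub_nonneg.2 ht.2) ht.1.le (sub_add_cancel 1 t), ?_⟩
  have hconv := (convexOn_realKL hP).2 hV hWm (sub_nonneg.2 ht.2) ht.1.le (sub_add_cancel 1 t)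
  rw [realKL_self, smul_zero, add_zero, smul_eq_mul] at hconv
  rw [exponentObjective, max_eq_right (sub_nonpos.2 htR.le), add_zero]
  nlinarith [mul_pos ht.1 hpos]

end Exponent

theorem EsCC_pos_and_strictMono
    {𝒳 𝒵 : Type*} [Fintype 𝒳] [Fintype 𝒵] [Nonempty 𝒳] [Nonempty 𝒵]
    (P_X : 𝒳 → ℝ) (W : 𝒳 → 𝒵 → ℝ) (hP : IsPMF P_X) (hW : IsChannel W)
    (R R' : ℝ) (hR : mutInfo P_X W < R) (hRR' : R < R') :
    (0 : EReal) < EsCC P_X W R ∧ EsCC P_X W R < EsCC P_X W R' := by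
  obtain ⟨V, hV, hE⟩ := exists_EsCC_eq hP hW R
  obtain ⟨V', hV', hE'⟩ := exists_EsCC_eq hP hW R'
  obtain ⟨U, hU, hlt⟩ := exists_exponentObjective_lt hP hW hV' hR hRR'
  constructor
  · rw [hE]
    exact EReal.coe_pos.2 (exponentObjective_pos hP hW hV hR)
  · rw [hE']
    exact (EsCC_le hP hW hU R).trans_lt (EReal.coe_lt_coe_iff.2 hlt)

end
end

section
/- Fix finite nonempty sets 𝒳, 𝒵 and a channel W from 𝒳 to 𝒵. For a joint pmf Q on 𝒳×𝒵 define φ(Q) := min{ D(Q'‖Q'_X×W) : Q' a joint pmf on 𝒳×𝒵 with Q'_X = Q_X and Q'_Z = Q_Z }. Then φ is convex on the set 𝒬 := { Q : Q ≪ Q_X×W }: for all Q₁, Q₂ ∈ 𝒬 and λ ∈ [0,1], φ(λQ₁ + (1−λ)Q₂) ≤ λ φ(Q₁) + (1−λ) φ(Q₂). -/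
open Filter

noncomputable section

open scoped Classical in
/-- Extended-real KL divergence: `+∞` when `Q` is not absolutely continuous w.r.t. `Q'`. -/
def klDivE {α : Type*} [Fintype α] (Q Q' : α → ℝ) : EReal :=
  if AbsCont Q Q' then ((klDiv Q Q' : ℝ) : EReal) else ⊤

/-- `φ(Q) = min{ D(Q'‖Q'_X×W) : Q' a joint pmf with the same marginals as Q }`. -/
def phi {𝒳 𝒵 : Type*} [Fintype 𝒳] [Fintype 𝒵]
    (W : 𝒳 → 𝒵 → ℝ) (Q : 𝒳 × 𝒵 → ℝ) : EReal :=
  sInf { d : EReal | ∃ Q' : 𝒳 × 𝒵 → ℝ, IsPMF Q' ∧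
    margX Q' = margX Q ∧ margZ Q' = margZ Q ∧
    d = klDivE Q' (jointPW (margX Q') W) }

/-- The tangent-line bound `a log k + a - r k ≤ a log (a / r)`. -/
theorem tangent_le_mul_log_div {a r k : ℝ} (ha : 0 ≤ a) (hr : 0 ≤ r) (har : 0 < a → 0 < r)
    (hk : 0 < k) : a * Real.log k + a - r * k ≤ a * Real.log (a / r) := by
  rcases ha.eq_or_lt with rfl | ha
  · simpa using mul_nonneg hr hk.le
  · have hr := har ha
    have h := Real.log_le_sub_one_of_pos (show 0 < k / (a / r) by positivity)
    rw [Real.log_div hk.ne' (by positivity)] at h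
    have h' := mul_le_mul_of_nonneg_left h ha.le
    have e : a * (k / (a / r) - 1) = r * k - a := by field_simp
    linarith

/-- Joint convexity of `(a, r) ↦ a log (a / r)`. -/
theorem mul_log_div_convex {a b r s l m : ℝ} (ha : 0 ≤ a) (hb : 0 ≤ b) (hr : 0 ≤ r) (hs : 0 ≤ s)
    (har : 0 < a → 0 < r) (hbs : 0 < b → 0 < s) (hl : 0 ≤ l) (hm : 0 ≤ m) :
    (l * a + m * b) * Real.log ((l * a + m * b) / (l * r + m * s)) ≤
      l * (a * Real.log (a / r)) + m * (b * Real.log (b / s)) := by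
  have hla := mul_nonneg hl ha
  have hmb := mul_nonneg hm hb
  have hlr := mul_nonneg hl hr
  have hms := mul_nonneg hm hs
  rcases (add_nonneg hla hmb).eq_or_lt with h | h
  · have h1 : l * a = 0 := by linarith
    have h2 : m * b = 0 := by linarith
    simp [h1, h2, ← mul_assoc]
  · have hu : 0 < l * r + m * s := by
      by_contra! hu
      have h1 : l * r = 0 := by linarith
      have h2 : m * s = 0 := by linarith
      have h3 : l * a = 0 := by
        rcases mul_eq_zero.1 h1 with h | h
        · simp [h]
        · rw [le_antisymm (not_lt.1 fun h' => (har h').ne' h) ha, mul_zero]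
      have h4 : m * b = 0 := by
        rcases mul_eq_zero.1 h2 with h | h
        · simp [h]
        · rw [le_antisymm (not_lt.1 fun h' => (hbs h').ne' h) hb, mul_zero]
      linarith
    have hk : 0 < (l * a + m * b) / (l * r + m * s) := div_pos h hu
    have e : (l * r + m * s) * ((l * a + m * b) / (l * r + m * s)) = l * a + m * b :=
      mul_div_cancel₀ _ hu.ne'
    generalize (l * a + m * b) / (l * r + m * s) = k at hk e ⊢
    have h1 := mul_le_mul_of_nonneg_left (tangent_le_mul_log_div ha hr har hk) hl
    have h2 := mul_le_mul_of_nonneg_left (tangent_le_mul_log_div hb hs hbs hk) hm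
    linarith

theorem klDiv_eq_sum {α : Type*} [Fintype α] {Q : α → ℝ} (hQ : ∀ a, 0 ≤ Q a) (R : α → ℝ) :
    klDiv Q R = ∑ a, Q a * Real.log (Q a / R a) := by
  refine Finset.sum_congr rfl fun a _ => ?_
  split_ifs with h
  · rfl
  · simp [le_antisymm (not_lt.1 h) (hQ a)]

theorem klDiv_nonneg {α : Type*} [Fintype α] {Q R : α → ℝ} (hQ : IsPMF Q) (hR : IsPMF R)
    (hQR : AbsCont Q R) : 0 ≤ klDiv Q R := by
  rw [klDiv_eq_sum hQ.1]
  calc (0 : ℝ) = ∑ a, (Q a * Real.log 1 + Q a - R a * 1) := by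
        simp [Finset.sum_sub_distrib, hQ.2, hR.2]
    _ ≤ _ := Finset.sum_le_sum fun a _ =>
        tangent_le_mul_log_div (hQ.1 a) (hR.1 a) (hQR a) one_pos

theorem klDiv_convex {α : Type*} [Fintype α] {Q₁ Q₂ R₁ R₂ : α → ℝ} (hQ₁ : ∀ a, 0 ≤ Q₁ a)
    (hQ₂ : ∀ a, 0 ≤ Q₂ a) (hR₁ : ∀ a, 0 ≤ R₁ a) (hR₂ : ∀ a, 0 ≤ R₂ a) (h₁ : AbsCont Q₁ R₁)
    (h₂ : AbsCont Q₂ R₂) {l m : ℝ} (hl : 0 ≤ l) (hm : 0 ≤ m) :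
    klDiv (fun a => l * Q₁ a + m * Q₂ a) (fun a => l * R₁ a + m * R₂ a) ≤
      l * klDiv Q₁ R₁ + m * klDiv Q₂ R₂ := by
  rw [klDiv_eq_sum hQ₁, klDiv_eq_sum hQ₂,
    klDiv_eq_sum fun a => add_nonneg (mul_nonneg hl (hQ₁ a)) (mul_nonneg hm (hQ₂ a)),
    Finset.mul_sum, Finset.mul_sum, ← Finset.sum_add_distrib]
  exact Finset.sum_le_sum fun a _ =>
    mul_log_div_convex (hQ₁ a) (hQ₂ a) (hR₁ a) (hR₂ a) (h₁ a) (h₂ a) hl hm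

theorem AbsCont.convex_comb {α : Type*} {Q₁ Q₂ R₁ R₂ : α → ℝ} (hQ₁ : ∀ a, 0 ≤ Q₁ a)
    (hQ₂ : ∀ a, 0 ≤ Q₂ a) (hR₁ : ∀ a, 0 ≤ R₁ a) (hR₂ : ∀ a, 0 ≤ R₂ a) (h₁ : AbsCont Q₁ R₁)
    (h₂ : AbsCont Q₂ R₂) {l m : ℝ} (hl : 0 ≤ l) (hm : 0 ≤ m) :
    AbsCont (fun a => l * Q₁ a + m * Q₂ a) (fun a => l * R₁ a + m * R₂ a) := by
  intro a (ha : 0 < l * Q₁ a + m * Q₂ a)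
  have hlr := mul_nonneg hl (hR₁ a)
  have hms := mul_nonneg hm (hR₂ a)
  rcases (mul_nonneg hl (hQ₁ a)).eq_or_lt with h | h
  · have h' : 0 < m * Q₂ a := by linarith
    have hm' : 0 < m := pos_of_mul_pos_left h' (hQ₂ a)
    exact add_pos_of_nonneg_of_pos hlr (mul_pos hm' (h₂ a (pos_of_mul_pos_right h' hm)))
  · have hl' : 0 < l := pos_of_mul_pos_left h (hQ₁ a)
    exact add_pos_of_pos_of_nonneg (mul_pos hl' (h₁ a (pos_of_mul_pos_right h hl))) hms

theorem IsPMF.convex_comb {α : Type*} [Fintype α] {Q₁ Q₂ : α → ℝ} (h₁ : IsPMF Q₁)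
    (h₂ : IsPMF Q₂) {l m : ℝ} (hl : 0 ≤ l) (hm : 0 ≤ m) (hlm : l + m = 1) :
    IsPMF (fun a => l * Q₁ a + m * Q₂ a) :=
  ⟨fun a => add_nonneg (mul_nonneg hl (h₁.1 a)) (mul_nonneg hm (h₂.1 a)), by
    simp [Finset.sum_add_distrib, ← Finset.mul_sum, h₁.2, h₂.2, hlm]⟩

theorem margX_convex_comb {𝒳 𝒵 : Type*} [Fintype 𝒵] (Q₁ Q₂ : 𝒳 × 𝒵 → ℝ) (l m : ℝ) :
    margX (fun a => l * Q₁ a + m * Q₂ a) = fun x => l * margX Q₁ x + m * margX Q₂ x := by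
  funext x
  simp [margX, Finset.sum_add_distrib, Finset.mul_sum]

theorem margZ_convex_comb {𝒳 𝒵 : Type*} [Fintype 𝒳] (Q₁ Q₂ : 𝒳 × 𝒵 → ℝ) (l m : ℝ) :
    margZ (fun a => l * Q₁ a + m * Q₂ a) = fun z => l * margZ Q₁ z + m * margZ Q₂ z := by
  funext z
  simp [margZ, Finset.sum_add_distrib, Finset.mul_sum]

theorem jointPW_convex_comb {𝒳 𝒵 : Type*} (P₁ P₂ : 𝒳 → ℝ) (W : 𝒳 → 𝒵 → ℝ)
    (l m : ℝ) :
    jointPW (fun x => l * P₁ x + m * P₂ x) W =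
      fun a => l * jointPW P₁ W a + m * jointPW P₂ W a := by
  funext a
  simp only [jointPW]
  ring

section Joint

variable {𝒳 𝒵 : Type*} [Fintype 𝒳] [Fintype 𝒵]

theorem IsPMF.margX {Q : 𝒳 × 𝒵 → ℝ} (hQ : IsPMF Q) : IsPMF (margX Q) :=
  ⟨fun _ => Finset.sum_nonneg fun _ _ => hQ.1 _, by
    simpa only [_root_.margX, ← Fintype.sum_prod_type] using hQ.2⟩

theorem IsPMF.jointPW {P : 𝒳 → ℝ} (hP : IsPMF P) {W : 𝒳 → 𝒵 → ℝ} (hW : IsChannel W) :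
    IsPMF (jointPW P W) :=
  ⟨fun a => mul_nonneg (hP.1 _) ((hW _).1 _), by
    simp [_root_.jointPW, Fintype.sum_prod_type, ← Finset.mul_sum, (hW _).2, hP.2]⟩

theorem phi_nonneg {W : 𝒳 → 𝒵 → ℝ} (hW : IsChannel W) (Q : 𝒳 × 𝒵 → ℝ) : 0 ≤ phi W Q := by
  refine le_sInf ?_
  rintro _ ⟨Q', hQ', -, -, rfl⟩
  unfold klDivE
  split_ifs with h
  · exact EReal.coe_nonneg.2 (klDiv_nonneg hQ' (hQ'.margX.jointPW hW) h)
  · exact le_top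

theorem phi_le_klDiv {W : 𝒳 → 𝒵 → ℝ} {Q Q' : 𝒳 × 𝒵 → ℝ} (hQ' : IsPMF Q')
    (hX : margX Q' = margX Q) (hZ : margZ Q' = margZ Q)
    (hac : AbsCont Q' (jointPW (margX Q') W)) :
    phi W Q ≤ (klDiv Q' (jointPW (margX Q') W) : ℝ) :=
  sInf_le ⟨Q', hQ', hX, hZ, (if_pos hac).symm⟩

theorem exists_phi_eq_coe {W : 𝒳 → 𝒵 → ℝ} (hW : IsChannel W) {Q : 𝒳 × 𝒵 → ℝ} (hQ : IsPMF Q)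
    (hac : AbsCont Q (jointPW (margX Q) W)) : ∃ p : ℝ, phi W Q = p :=
  ⟨(phi W Q).toReal, (EReal.coe_toReal
    ((phi_le_klDiv hQ rfl rfl hac).trans_lt (EReal.coe_lt_top _)).ne
    ((EReal.bot_lt_zero).trans_le (phi_nonneg hW Q)).ne').symm⟩

theorem exists_klDiv_lt_of_phi_lt {W : 𝒳 → 𝒵 → ℝ} {Q : 𝒳 × 𝒵 → ℝ} {c : ℝ}
    (h : phi W Q < c) : ∃ Q' : 𝒳 × 𝒵 → ℝ, IsPMF Q' ∧ margX Q' = margX Q ∧ margZ Q' = margZ Q ∧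
      AbsCont Q' (jointPW (margX Q') W) ∧ klDiv Q' (jointPW (margX Q') W) < c := by
  obtain ⟨_, ⟨Q', hQ', hX, hZ, rfl⟩, hlt⟩ := sInf_lt_iff.1 h
  unfold klDivE at hlt
  split_ifs at hlt with hac
  · exact ⟨Q', hQ', hX, hZ, hac, EReal.coe_lt_coe_iff.1 hlt⟩
  · exact absurd hlt not_top_lt

end Joint

theorem phi_convex
    {𝒳 𝒵 : Type*} [Fintype 𝒳] [Fintype 𝒵] [Nonempty 𝒳] [Nonempty 𝒵]
    (W : 𝒳 → 𝒵 → ℝ) (hW : IsChannel W)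
    (Q₁ Q₂ : 𝒳 × 𝒵 → ℝ) (hQ₁ : IsPMF Q₁) (hQ₂ : IsPMF Q₂)
    (hac₁ : AbsCont Q₁ (jointPW (margX Q₁) W))
    (hac₂ : AbsCont Q₂ (jointPW (margX Q₂) W))
    (lam : ℝ) (hlam0 : 0 ≤ lam) (hlam1 : lam ≤ 1) :
    phi W (fun a => lam * Q₁ a + (1 - lam) * Q₂ a)
      ≤ ((lam : ℝ) : EReal) * phi W Q₁ + (((1 - lam : ℝ)) : EReal) * phi W Q₂ := by
  have hm : 0 ≤ 1 - lam := sub_nonneg.2 hlam1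
  obtain ⟨p₁, hp₁⟩ := exists_phi_eq_coe hW hQ₁ hac₁
  obtain ⟨p₂, hp₂⟩ := exists_phi_eq_coe hW hQ₂ hac₂
  have hmix : ∀ {R₁ R₂ : 𝒳 × 𝒵 → ℝ}, IsPMF R₁ → IsPMF R₂ →
      AbsCont R₁ (jointPW (margX R₁) W) → AbsCont R₂ (jointPW (margX R₂) W) →
      margX R₁ = margX Q₁ → margX R₂ = margX Q₂ → margZ R₁ = margZ Q₁ → margZ R₂ = margZ Q₂ →
      phi W (fun a => lam * Q₁ a + (1 - lam) * Q₂ a) ≤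
        ((lam * klDiv R₁ (jointPW (margX R₁) W) +
          (1 - lam) * klDiv R₂ (jointPW (margX R₂) W) : ℝ) : EReal) := by
    intro R₁ R₂ h₁ h₂ ha₁ ha₂ hX₁ hX₂ hZ₁ hZ₂
    have hJ₁ := (h₁.margX.jointPW hW).1
    have hJ₂ := (h₂.margX.jointPW hW).1
    have hJ : jointPW (margX fun a => lam * R₁ a + (1 - lam) * R₂ a) W = fun a =>
        lam * jointPW (margX R₁) W a + (1 - lam) * jointPW (margX R₂) W a := by
      rw [margX_convex_comb, jointPW_convex_comb]
    refine (phi_le_klDiv (h₁.convex_comb h₂ hlam0 hm (by ring)) ?_ ?_ ?_).trans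
      (EReal.coe_le_coe_iff.2 ?_)
    · simp only [margX_convex_comb, hX₁, hX₂]
    · simp only [margZ_convex_comb, hZ₁, hZ₂]
    · rw [hJ]
      exact ha₁.convex_comb h₁.1 h₂.1 hJ₁ hJ₂ ha₂ hlam0 hm
    · rw [hJ]
      exact klDiv_convex h₁.1 h₂.1 hJ₁ hJ₂ ha₁ ha₂ hlam0 hm
  rw [hp₁, hp₂, ← EReal.coe_mul, ← EReal.coe_mul, ← EReal.coe_add]
  refine EReal.le_of_forall_lt_iff_le.1 fun c hc => ?_
  have hε : 0 < c - (lam * p₁ + (1 - lam) * p₂) := sub_pos.2 (EReal.coe_lt_coe_iff.1 hc)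
  obtain ⟨R₁, h₁, hX₁, hZ₁, ha₁, hlt₁⟩ := exists_klDiv_lt_of_phi_lt
    (hp₁.trans_lt (EReal.coe_lt_coe_iff.2 (lt_add_of_pos_right p₁ hε)))
  obtain ⟨R₂, h₂, hX₂, hZ₂, ha₂, hlt₂⟩ := exists_klDiv_lt_of_phi_lt
    (hp₂.trans_lt (EReal.coe_lt_coe_iff.2 (lt_add_of_pos_right p₂ hε)))
  refine (hmix h₁ h₂ ha₁ ha₂ hX₁ hX₂ hZ₁ hZ₂).trans (EReal.coe_le_coe_iff.2 ?_)
  have := mul_le_mul_of_nonneg_left hlt₁.le hlam0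
  have := mul_le_mul_of_nonneg_left hlt₂.le hm
  linarith

end
end

section
/- Fix finite nonempty sets 𝒳, 𝒵 and a channel W from 𝒳 to 𝒵. For a joint pmf Q on 𝒳×𝒵 define φ(Q) := min{ D(Q'‖Q'_X×W) : Q' a joint pmf with Q'_X = Q_X and Q'_Z = Q_Z }, and for each positive integer n define φ_n(Q) := min{ D(Q'‖Q'_X×W) : Q' an n-type on 𝒳×𝒵 with Q'_X = Q_X and Q'_Z = Q_Z }. Let (Q_n) be a sequence where each Q_n is an n-type on 𝒳×𝒵 with Q_n ≪ (Q_n)_X×W, and suppose Q_n converges (in ℓ1) to a joint pmf Q with Q ≪ Q_X×W. Then lim_{n→∞} φ_n(Q_n) = φ(Q). -/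
open Filter

noncomputable section

/-- `Q` is an `n`-type: `n·Q(a)` is an integer for every `a`. -/
def IsType {α : Type*} (n : ℕ) (Q : α → ℝ) : Prop :=
  ∀ a, ∃ k : ℕ, Q a = (k : ℝ) / n

/-- `φ_n(Q) = min{ D(Q'‖Q'_X×W) : Q' an n-type joint pmf with the same marginals as Q }`. -/
def phiN {𝒳 𝒵 : Type*} [Fintype 𝒳] [Fintype 𝒵] (n : ℕ)
    (W : 𝒳 → 𝒵 → ℝ) (Q : 𝒳 × 𝒵 → ℝ) : EReal :=
  sInf { d : EReal | ∃ Q' : 𝒳 × 𝒵 → ℝ, IsPMF Q' ∧ IsType n Q' ∧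
    margX Q' = margX Q ∧ margZ Q' = margZ Q ∧
    d = klDivE Q' (jointPW (margX Q') W) }

/-- A continuous extension of `Q ↦ D(Q‖Q_X×W)` to all real matrices. -/
def entropyForm {𝒳 𝒵 : Type*} [Fintype 𝒳] [Fintype 𝒵] (W : 𝒳 → 𝒵 → ℝ) (Q : 𝒳 × 𝒵 → ℝ) : ℝ :=
  ∑ p, -Real.negMulLog (Q p) + ∑ x, Real.negMulLog (margX Q x) - ∑ p, Q p * Real.log (W p.1 p.2)

lemma IsPMF.le_one {α : Type*} [Fintype α] {p : α → ℝ} (hp : IsPMF p) (a : α) : p a ≤ 1 :=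
  hp.2 ▸ Finset.single_le_sum (fun b _ => hp.1 b) (Finset.mem_univ a)

lemma tendsto_int_floor_mul_div_atTop (a : ℝ) :
    Tendsto (fun x : ℝ => (⌊a * x⌋ : ℝ) / x) atTop (nhds a) := by
  have h : Tendsto (fun x : ℝ => a - x⁻¹) atTop (nhds a) := by
    simpa using tendsto_const_nhds.sub (tendsto_inv_atTop_zero (𝕜 := ℝ))
  refine tendsto_of_tendsto_of_tendsto_of_le_of_le' h tendsto_const_nhds ?_ ?_
  · filter_upwards [eventually_gt_atTop 0] with x hx
    rw [le_div_iff₀ hx, sub_mul, inv_mul_cancel₀ hx.ne']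
    exact (Int.sub_one_lt_floor (a * x)).le
  · filter_upwards [eventually_gt_atTop 0] with x hx
    rw [div_le_iff₀ hx]
    exact Int.floor_le _

/-- A real vector is a real combination of integer vectors, obtained from it by applying additive
maps coordinatewise; hence these satisfy every rational linear relation that it satisfies. -/
lemma exists_integer_decomposition {α : Type*} [Fintype α] (v : α → ℝ) :
    ∃ (ι : Type) (J : Finset ι) (c : ι → ℝ) (f : ι → ℝ →+ ℝ),
      (∀ a, v a = ∑ j ∈ J, c j * f j (v a)) ∧ ∀ j a, ∃ k : ℤ, f j (v a) = k := by
  classical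
  let b := Module.Basis.ofVectorSpace ℚ ℝ
  let I := Finset.univ.biUnion fun a => (b.repr (v a)).support
  let N : Module.Basis.ofVectorSpaceIndex ℚ ℝ → ℕ := fun j => ∏ a, ((b.repr (v a)) j).den
  have hN : ∀ j, (N j : ℝ) ≠ 0 := fun j =>
    Nat.cast_ne_zero.2 (Finset.prod_ne_zero_iff.2 fun a _ => Rat.den_nz _)
  let g : Module.Basis.ofVectorSpaceIndex ℚ ℝ → ℝ →+ ℝ := fun j =>
    (AddMonoidHom.mulLeft (N j : ℝ)).comp
      ((Rat.castHom ℝ).toAddMonoidHom.comp (b.coord j).toAddMonoidHom)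
  have hg : ∀ j x, g j x = N j * ((b.repr x j : ℚ) : ℝ) := fun j x => rfl
  refine ⟨_, I, fun j => b j / N j, g, fun a => ?_, fun j a => ?_⟩
  · have h1 : v a = ∑ j ∈ I, (b.repr (v a) j) • b j := by
      conv_lhs => rw [← b.linearCombination_repr (v a), Finsupp.linearCombination_apply]
      exact Finsupp.sum_of_support_subset _
        (Finset.subset_biUnion_of_mem (fun a => (b.repr (v a)).support) (Finset.mem_univ a)) _
        (by simp)
    refine h1.trans (Finset.sum_congr rfl fun j _ => ?_)
    rw [hg, Rat.smul_def]
    field_simp [hN j]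
  · obtain ⟨m, hm⟩ : ((b.repr (v a)) j).den ∣ N j := Finset.dvd_prod_of_mem _ (Finset.mem_univ a)
    refine ⟨m * ((b.repr (v a)) j).num, ?_⟩
    have hq : (((b.repr (v a)) j : ℚ) : ℝ) * ((b.repr (v a)) j).den = ((b.repr (v a)) j).num := by
      exact_mod_cast Rat.mul_den_eq_num _
    rw [hg, hm]
    push_cast
    rw [← hq]
    ring

lemma continuous_margX {𝒳 𝒵 : Type*} [Fintype 𝒵] :
    Continuous (margX : (𝒳 × 𝒵 → ℝ) → 𝒳 → ℝ) := by
  unfold margX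
  fun_prop

lemma continuous_margZ {𝒳 𝒵 : Type*} [Fintype 𝒳] :
    Continuous (margZ : (𝒳 × 𝒵 → ℝ) → 𝒵 → ℝ) := by
  unfold margZ
  fun_prop

lemma le_margX {𝒳 𝒵 : Type*} [Fintype 𝒵] {Q : 𝒳 × 𝒵 → ℝ} (hQ : ∀ p, 0 ≤ Q p)
    (p : 𝒳 × 𝒵) : Q p ≤ margX Q p.1 :=
  Finset.single_le_sum (f := fun z => Q (p.1, z)) (fun z _ => hQ (p.1, z)) (Finset.mem_univ p.2)

lemma AbsCont.eq_zero_of_jointPW {𝒳 𝒵 : Type*} {Q : 𝒳 × 𝒵 → ℝ} {P : 𝒳 → ℝ}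
    {W : 𝒳 → 𝒵 → ℝ}
    (h : AbsCont Q (jointPW P W)) (hQ : ∀ p, 0 ≤ Q p) (p : 𝒳 × 𝒵) (hp : W p.1 p.2 = 0) :
    Q p = 0 := by
  by_contra hne
  have := h p (lt_of_le_of_ne (hQ p) (Ne.symm hne))
  simp [jointPW, hp] at this

section

variable {𝒳 𝒵 : Type*} [Fintype 𝒳] [Fintype 𝒵]

lemma continuous_entropyForm (W : 𝒳 → 𝒵 → ℝ) : Continuous (entropyForm W) := by
  have h (x : 𝒳) : Continuous fun Q : 𝒳 × 𝒵 → ℝ => margX Q x :=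
    (continuous_apply x).comp continuous_margX
  unfold entropyForm
  refine ((continuous_finsetSum _ fun p _ => ?_).add (continuous_finsetSum _ fun x _ => ?_)).sub
    (continuous_finsetSum _ fun p _ => ?_)
  · exact (Real.continuous_negMulLog.comp (continuous_apply p)).neg
  · exact Real.continuous_negMulLog.comp (h x)
  · fun_prop

lemma sum_eq_sum_margX (Q : 𝒳 × 𝒵 → ℝ) : ∑ p, Q p = ∑ x, margX Q x :=
  Fintype.sum_prod_type _

lemma isPMF_of_margX_eq {Q Q' : 𝒳 × 𝒵 → ℝ} (hQ : IsPMF Q) (h0 : ∀ p, 0 ≤ Q' p)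
    (hX : margX Q' = margX Q) : IsPMF Q' :=
  ⟨h0, by rw [sum_eq_sum_margX, hX, ← sum_eq_sum_margX, hQ.2]⟩

lemma klDivE_jointPW_eq {W : 𝒳 → 𝒵 → ℝ} (hW : IsChannel W) {Q : 𝒳 × 𝒵 → ℝ}
    (hQ : ∀ p, 0 ≤ Q p) (hs : ∀ p, W p.1 p.2 = 0 → Q p = 0) :
    klDivE Q (jointPW (margX Q) W) = (entropyForm W Q : EReal) := by
  have hpos : ∀ p, 0 < Q p → 0 < margX Q p.1 ∧ 0 < W p.1 p.2 := fun p hp =>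
    ⟨hp.trans_le (le_margX hQ p),
      lt_of_le_of_ne ((hW p.1).1 p.2) fun h => hp.ne' (hs p h.symm)⟩
  have hac : AbsCont Q (jointPW (margX Q) W) := fun p hp => mul_pos (hpos p hp).1 (hpos p hp).2
  rw [klDivE, if_pos hac]
  congr 1
  have hX : ∑ x, Real.negMulLog (margX Q x) = ∑ p, -(Q p * Real.log (margX Q p.1)) := by
    rw [Fintype.sum_prod_type]
    refine Finset.sum_congr rfl fun x _ => ?_
    simp only [Finset.sum_neg_distrib, ← Finset.sum_mul, Real.negMulLog, neg_mul]
    rfl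
  rw [klDiv, entropyForm, hX, ← Finset.sum_add_distrib, ← Finset.sum_sub_distrib]
  refine Finset.sum_congr rfl fun p _ => ?_
  split_ifs with hp
  · obtain ⟨h1, h2⟩ := hpos p hp
    rw [jointPW, Real.log_div hp.ne' (mul_pos h1 h2).ne', Real.log_mul h1.ne' h2.ne',
      Real.negMulLog]
    ring
  · simp [le_antisymm (not_lt.1 hp) (hQ p)]

lemma entropyForm_lt_of_klDivE_lt {W : 𝒳 → 𝒵 → ℝ} (hW : IsChannel W) {Q : 𝒳 × 𝒵 → ℝ}
    (hQ : ∀ p, 0 ≤ Q p) {c : EReal} (h : klDivE Q (jointPW (margX Q) W) < c) :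
    (∀ p, W p.1 p.2 = 0 → Q p = 0) ∧ (entropyForm W Q : EReal) < c := by
  have hac : AbsCont Q (jointPW (margX Q) W) := by
    by_contra hn
    rw [klDivE, if_neg hn] at h
    exact not_top_lt h
  have hs := hac.eq_zero_of_jointPW hQ
  exact ⟨hs, klDivE_jointPW_eq hW hQ hs ▸ h⟩

/-- If types `Qn n` converge to `Q`, then any `R` with the marginals of `Q` that is positive
wherever it differs from `Q` is a limit of types with the marginals of `Qn n`. -/
lemma exists_types_tendsto {Qn : ℕ → 𝒳 × 𝒵 → ℝ} {Q R : 𝒳 × 𝒵 → ℝ}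
    (hQn : ∀ n, 0 < n → IsPMF (Qn n) ∧ IsType n (Qn n)) (hconv : Tendsto Qn atTop (nhds Q))
    (hX : margX R = margX Q) (hZ : margZ R = margZ Q) (hpos : ∀ p, R p ≠ Q p → 0 < R p) :
    ∃ K : ℕ → 𝒳 × 𝒵 → ℝ, Tendsto K atTop (nhds R) ∧
      (∀ n p, R p = Q p → K n p = Qn n p) ∧
      ∀ᶠ n in atTop, IsPMF (K n) ∧ IsType n (K n) ∧
        margX (K n) = margX (Qn n) ∧ margZ (K n) = margZ (Qn n) := by
  obtain ⟨ι, J, c, f, hv, hint⟩ := exists_integer_decomposition (fun p => R p - Q p)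
  choose k hk using hint
  let K : ℕ → 𝒳 × 𝒵 → ℝ := fun n p =>
    Qn n p + ∑ j ∈ J, (⌊c j * n⌋ : ℝ) / n * f j (R p - Q p)
  have hlim : Tendsto K atTop (nhds R) := by
    rw [tendsto_pi_nhds] at hconv ⊢
    intro p
    have hR : R p = Q p + ∑ j ∈ J, c j * f j (R p - Q p) := by rw [← hv p]; ring
    rw [hR]
    refine (hconv p).add (tendsto_finsetSum _ fun j _ => Tendsto.mul_const _ ?_)
    exact (tendsto_int_floor_mul_div_atTop (c j)).comp tendsto_natCast_atTop_atTop
  have heq : ∀ n p, R p = Q p → K n p = Qn n p := by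
    intro n p h
    simp [K, h]
  have hKX : ∀ n, margX (K n) = margX (Qn n) := by
    intro n
    funext x
    have h : ∀ j, ∑ z, f j (R (x, z) - Q (x, z)) = 0 := by
      intro j
      have := congrFun hX x
      simp only [margX] at this
      rw [← map_sum, Finset.sum_sub_distrib, this, sub_self, map_zero]
    simp only [margX, K, Finset.sum_add_distrib]
    rw [Finset.sum_comm]
    simp only [← Finset.mul_sum, h, mul_zero, Finset.sum_const_zero, add_zero]
  have hKZ : ∀ n, margZ (K n) = margZ (Qn n) := by
    intro n
    funext z
    have h : ∀ j, ∑ x, f j (R (x, z) - Q (x, z)) = 0 := by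
      intro j
      have := congrFun hZ z
      simp only [margZ] at this
      rw [← map_sum, Finset.sum_sub_distrib, this, sub_self, map_zero]
    simp only [margZ, K, Finset.sum_add_distrib]
    rw [Finset.sum_comm]
    simp only [← Finset.mul_sum, h, mul_zero, Finset.sum_const_zero, add_zero]
  refine ⟨K, hlim, heq, ?_⟩
  have hnonneg : ∀ᶠ n in atTop, ∀ p, 0 ≤ K n p := by
    rw [eventually_all]
    intro p
    by_cases h : R p = Q p
    · filter_upwards [eventually_gt_atTop 0] with n hn
      rw [heq n p h]
      exact (hQn n hn).1.1 p
    · exact ((tendsto_pi_nhds.1 hlim p).eventually_const_lt (hpos p h)).mono fun _ h => h.le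
  filter_upwards [hnonneg, eventually_gt_atTop 0] with n h0 hn
  obtain ⟨hpmf, htype⟩ := hQn n hn
  refine ⟨isPMF_of_margX_eq hpmf h0 (hKX n), fun p => ?_, hKX n, hKZ n⟩
  obtain ⟨m, hm⟩ := htype p
  have hn' : (0 : ℝ) < n := Nat.cast_pos.2 hn
  have hK : K n p = ((m + ∑ j ∈ J, ⌊c j * n⌋ * k j p : ℤ) : ℝ) / n := by
    simp only [K, hm, hk]
    push_cast
    rw [add_div, Finset.sum_div]
    congr 1
    exact Finset.sum_congr rfl fun j _ => by ring
  obtain ⟨l, hl⟩ : ∃ l : ℕ, (m + ∑ j ∈ J, ⌊c j * n⌋ * k j p : ℤ) = l := by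
    refine Int.eq_ofNat_of_zero_le ?_
    have := h0 p
    rw [hK, le_div_iff₀ hn', zero_mul] at this
    exact_mod_cast this
  exact ⟨l, by rw [hK, hl, Int.cast_natCast]⟩

lemma eventually_lt_phiN {W : 𝒳 → 𝒵 → ℝ} (hW : IsChannel W) {Qn : ℕ → 𝒳 × 𝒵 → ℝ}
    {Q : 𝒳 × 𝒵 → ℝ} (hQ : IsPMF Q) (hconv : Tendsto Qn atTop (nhds Q)) {c : EReal}
    (hc : c < phi W Q) : ∀ᶠ n in atTop, c < phiN n W (Qn n) := by
  obtain ⟨d, hcd, hd⟩ := EReal.lt_iff_exists_real_btwn.1 hc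
  by_contra hcon
  have hfreq : ∃ᶠ n in atTop, ∃ R : 𝒳 × 𝒵 → ℝ, IsPMF R ∧ margX R = margX (Qn n) ∧
      margZ R = margZ (Qn n) ∧ (∀ p, W p.1 p.2 = 0 → R p = 0) ∧ entropyForm W R ≤ d := by
    refine (not_eventually.1 hcon).mono fun n hn => ?_
    obtain ⟨e, ⟨R, hR, -, hX, hZ, rfl⟩, hlt⟩ := sInf_lt_iff.1 ((not_lt.1 hn).trans_lt hcd)
    obtain ⟨hs, hlt'⟩ := entropyForm_lt_of_klDivE_lt hW hR.1 hlt
    exact ⟨R, hR, hX, hZ, hs, (EReal.coe_lt_coe_iff.1 hlt').le⟩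
  obtain ⟨s, hs, hR⟩ := extraction_of_frequently_atTop hfreq
  choose R hpmf hX hZ hsupp hent using hR
  obtain ⟨R', -, t, ht, hlim⟩ := (isCompact_Icc (a := (0 : 𝒳 × 𝒵 → ℝ)) (b := 1)).tendsto_subseq
    (x := R) fun n => ⟨fun p => (hpmf n).1 p, fun p => (hpmf n).le_one p⟩
  have hQlim : Tendsto (fun n => Qn (s (t n))) atTop (nhds Q) :=
    hconv.comp ((hs.comp ht).tendsto_atTop)
  have h0 : ∀ p, 0 ≤ R' p := fun p =>
    ge_of_tendsto' (tendsto_pi_nhds.1 hlim p) fun n => (hpmf (t n)).1 p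
  have hX' : margX R' = margX Q := by
    refine tendsto_nhds_unique ((continuous_margX.tendsto _).comp hlim) ?_
    refine ((continuous_margX.tendsto _).comp hQlim).congr fun n => ?_
    exact (hX (t n)).symm
  have hZ' : margZ R' = margZ Q := by
    refine tendsto_nhds_unique ((continuous_margZ.tendsto _).comp hlim) ?_
    refine ((continuous_margZ.tendsto _).comp hQlim).congr fun n => ?_
    exact (hZ (t n)).symm
  have hsupp' : ∀ p, W p.1 p.2 = 0 → R' p = 0 := fun p hp =>
    tendsto_nhds_unique (tendsto_pi_nhds.1 hlim p)
      (tendsto_const_nhds.congr fun n => (hsupp (t n) p hp).symm)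
  have hent' : entropyForm W R' ≤ d :=
    le_of_tendsto' (((continuous_entropyForm W).tendsto _).comp hlim) fun n => hent (t n)
  refine hd.not_ge ?_
  refine le_trans (b := (entropyForm W R' : EReal)) (sInf_le ?_) (EReal.coe_le_coe_iff.2 hent')
  exact ⟨R', isPMF_of_margX_eq hQ h0 hX', hX', hZ', (klDivE_jointPW_eq hW h0 hsupp').symm⟩

lemma eventually_phiN_lt {W : 𝒳 → 𝒵 → ℝ} (hW : IsChannel W) {Qn : ℕ → 𝒳 × 𝒵 → ℝ}
    {Q : 𝒳 × 𝒵 → ℝ}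
    (hQn : ∀ n, 0 < n → IsPMF (Qn n) ∧ IsType n (Qn n) ∧
      AbsCont (Qn n) (jointPW (margX (Qn n)) W))
    (hQ : IsPMF Q) (hac : AbsCont Q (jointPW (margX Q) W))
    (hconv : Tendsto Qn atTop (nhds Q)) {c : EReal} (hc : phi W Q < c) :
    ∀ᶠ n in atTop, phiN n W (Qn n) < c := by
  obtain ⟨e, ⟨S, hS, hX, hZ, rfl⟩, hlt⟩ := sInf_lt_iff.1 hc
  obtain ⟨hs, hlt'⟩ := entropyForm_lt_of_klDivE_lt hW hS.1 hlt
  have hQs := hac.eq_zero_of_jointPW hQ.1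
  have hH : Continuous fun R : 𝒳 × 𝒵 → ℝ => (entropyForm W R : EReal) :=
    continuous_coe_real_ereal.comp (continuous_entropyForm W)
  let R : ℝ → 𝒳 × 𝒵 → ℝ := fun t p => Q p + t * (S p - Q p)
  have hR : Continuous R := by fun_prop
  have hR1 : R 1 = S := by funext p; simp [R]
  have hnear : ∀ᶠ t in nhdsWithin 1 (Set.Iio (1 : ℝ)), (entropyForm W (R t) : EReal) < c := by
    refine Filter.Eventually.filter_mono nhdsWithin_le_nhds ?_
    exact ((hH.comp hR).tendsto 1).eventually_lt_const (by simpa [hR1] using hlt')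
  obtain ⟨t, ht, ht1⟩ := (hnear.and (Ioo_mem_nhdsLT (zero_lt_one' ℝ))).exists
  have hRX : margX (R t) = margX Q := by
    funext x
    have := congrFun hX x
    simp only [margX] at this
    simp [margX, R, Finset.sum_add_distrib, ← Finset.mul_sum, this]
  have hRZ : margZ (R t) = margZ Q := by
    funext z
    have := congrFun hZ z
    simp only [margZ] at this
    simp [margZ, R, Finset.sum_add_distrib, ← Finset.mul_sum, this]
  have hpos : ∀ p, R t p ≠ Q p → 0 < R t p := by
    intro p hp
    have hne : S p ≠ Q p := fun h => hp (by simp [R, h])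
    have e : R t p = (1 - t) * Q p + t * S p := by simp only [R]; ring
    rw [e]
    rcases (hQ.1 p).lt_or_eq with h | h
    · exact add_pos_of_pos_of_nonneg (mul_pos (sub_pos.2 ht1.2) h)
        (mul_nonneg ht1.1.le (hS.1 p))
    · rw [← h] at hne ⊢
      simpa using mul_pos ht1.1 (lt_of_le_of_ne (hS.1 p) hne.symm)
  obtain ⟨K, hlim, heq, hK⟩ := exists_types_tendsto (fun n hn => ⟨(hQn n hn).1, (hQn n hn).2.1⟩)
    hconv hRX hRZ hpos
  filter_upwards [hK, ((hH.tendsto _).comp hlim).eventually_lt_const ht, eventually_gt_atTop 0]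
    with n ⟨hpmf, htype, hKX, hKZ⟩ hval hn
  refine lt_of_le_of_lt (sInf_le ⟨K n, hpmf, htype, hKX, hKZ, rfl⟩) ?_
  rw [klDivE_jointPW_eq hW hpmf.1]
  · exact hval
  · intro p hp
    rw [heq n p (by simp [R, hs p hp, hQs p hp])]
    exact (hQn n hn).2.2.eq_zero_of_jointPW (hQn n hn).1.1 p hp

end

theorem phiN_tendsto_phi
    {𝒳 𝒵 : Type*} [Fintype 𝒳] [Fintype 𝒵] [Nonempty 𝒳] [Nonempty 𝒵]
    (W : 𝒳 → 𝒵 → ℝ) (hW : IsChannel W)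
    (Qn : ℕ → 𝒳 × 𝒵 → ℝ) (Q : 𝒳 × 𝒵 → ℝ)
    (hQn : ∀ n, 0 < n → IsPMF (Qn n) ∧ IsType n (Qn n) ∧
      AbsCont (Qn n) (jointPW (margX (Qn n)) W))
    (hQ : IsPMF Q) (hac : AbsCont Q (jointPW (margX Q) W))
    (hconv : Filter.Tendsto (fun n => ∑ p, |Qn n p - Q p|) Filter.atTop (nhds 0)) :
    Filter.Tendsto (fun n => phiN n W (Qn n)) Filter.atTop (nhds (phi W Q)) := by
  have hlim : Tendsto Qn atTop (nhds Q) := by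
    refine tendsto_pi_nhds.2 fun p => tendsto_iff_dist_tendsto_zero.2 ?_
    refine squeeze_zero (fun _ => dist_nonneg) (fun n => ?_) hconv
    rw [Real.dist_eq]
    exact Finset.single_le_sum (f := fun p => |Qn n p - Q p|) (fun _ _ => abs_nonneg _)
      (Finset.mem_univ p)
  exact tendsto_order.2 ⟨fun _ hc => eventually_lt_phiN hW hQ hlim hc,
    fun _ hc => eventually_phiN_lt hW hQn hQ hac hlim hc⟩

end
end
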